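/- Let k ≥ 0 be an integer and assume σ ≥ k + 3/2. Then there exists a constant C > 0 depending only on σ, β and k (independent of ε, N and φ) such that Σ_{i=1}^{N/4} (min{h_i/√ε, 1})^{2k+3} · e^{−2β x_{i−1}/√ε} ≤ C · (N⁻¹ · sup_{t∈[0,1/4]} |ψ′(t)|)^{2(k+1)}. -/

import Mathlib

/-- A layer-adapted mesh for a singularly perturbed reaction–diffusion problem,
with parameters `β, σ > 0`, number of elements `N` (a multiple of 4, `N ≥ 4`),
perturbation parameter `ε` with `√ε ≤ N⁻¹`, and mesh-generating function `φ`
(with derivative `φ'` on `[0, 1/4]`). -/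
structure LayerMesh (β σ : ℝ) (N : ℕ) (ε : ℝ) (φ φ' : ℝ → ℝ) where
  hβ : 0 < β
  hσ : 0 < σ
  hN : 4 ≤ N
  hN4 : N % 4 = 0
  hε : 0 < ε
  hεN : Real.sqrt ε ≤ (N : ℝ)⁻¹
  hderiv : ∀ t ∈ Set.Icc (0:ℝ) (1/4), HasDerivWithinAt φ (φ' t) (Set.Icc (0:ℝ) (1/4)) t
  hcont : ContinuousOn φ' (Set.Icc (0:ℝ) (1/4))
  hφ0 : φ 0 = 0
  hφ'pos : ∀ t ∈ Set.Icc (0:ℝ) (1/4), 0 < φ' t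
  hφ'mono : ∀ s ∈ Set.Icc (0:ℝ) (1/4), ∀ t ∈ Set.Icc (0:ℝ) (1/4), s ≤ t → φ' s ≤ φ' t
  hτ : σ * Real.sqrt ε / β * φ (1/4) ≤ 1/4
  x : ℕ → ℝ
  hx_left : ∀ i : ℕ, i ≤ N / 4 → x i = σ * Real.sqrt ε / β * φ ((i : ℝ) / (N : ℝ))
  hx_mid : ∀ i : ℕ, N / 4 < i → i < 3 * N / 4 →
    x i = σ * Real.sqrt ε / β * φ (1/4)
      + 2 * (1 - 2 * (σ * Real.sqrt ε / β * φ (1/4))) * ((i : ℝ) / (N : ℝ) - 1/4)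
  hx_right : ∀ i : ℕ, 3 * N / 4 ≤ i → i ≤ N →
    x i = 1 - σ * Real.sqrt ε / β * φ (1 - (i : ℝ) / (N : ℝ))

namespace LayerMesh

variable {β σ ε : ℝ} {N : ℕ} {φ φ' : ℝ → ℝ}

/-- The mesh width `h_i = x_i − x_{i−1}`. -/
noncomputable def h (M : LayerMesh β σ N ε φ φ') (i : ℕ) : ℝ := M.x i - M.x (i - 1)

/-- The quantity `Θ_i = min{h_i/√ε, 1} · e^{−β x_{i−1}/(σ√ε)}`, for `1 ≤ i ≤ N/4`. -/
noncomputable def Θ (M : LayerMesh β σ N ε φ φ') (i : ℕ) : ℝ :=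
  min (M.h i / Real.sqrt ε) 1 * Real.exp (-(β * M.x (i - 1)) / (σ * Real.sqrt ε))

end LayerMesh

/-- `sup_{t ∈ [0,1/4]} |ψ'(t)|` where `ψ = e^{−φ}`, so `ψ' = −φ'·e^{−φ}`. -/
noncomputable def psiSup (φ φ' : ℝ → ℝ) : ℝ :=
  sSup ((fun t => |(-(φ' t)) * Real.exp (-(φ t))|) '' Set.Icc (0:ℝ) (1/4))

theorem min_mul_one_le_mul_one_sub_exp_neg {c δ : ℝ} (hc : 0 ≤ c) (hδ : 0 ≤ δ) :
    min (c * δ) 1 ≤ (1 + c) * (1 - Real.exp (-δ)) := by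
  have hmin : min (c * δ) 1 * (1 + δ) ≤ (1 + c) * δ := by
    nlinarith [min_le_left (c * δ) 1, mul_le_mul_of_nonneg_right (min_le_right (c * δ) 1) hδ]
  have hexp : Real.exp (-δ) * (1 + δ) ≤ 1 := by
    have h₁ : Real.exp (-δ) * Real.exp δ = 1 := by rw [← Real.exp_add]; simp
    have h₂ := mul_le_mul_of_nonneg_left (Real.add_one_le_exp δ) (Real.exp_pos (-δ)).le
    linarith
  refine le_of_mul_le_mul_right ?_ (show (0 : ℝ) < 1 + δ by linarith)
  nlinarith [mul_le_mul_of_nonneg_left hexp (show 0 ≤ 1 + c by linarith)]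

namespace LayerMesh

variable {β σ ε : ℝ} {N : ℕ} {φ φ' : ℝ → ℝ}

theorem monotoneOn (M : LayerMesh β σ N ε φ φ') : MonotoneOn φ (Set.Icc (0 : ℝ) (1 / 4)) := by
  refine monotoneOn_of_hasDerivWithinAt_nonneg (f' := φ') (convex_Icc _ _)
    (fun t ht => (M.hderiv t ht).continuousWithinAt)
    (fun t ht => (M.hderiv t (interior_subset ht)).mono interior_subset)
    (fun t ht => (M.hφ'pos t (interior_subset ht)).le)

theorem abs_deriv_le_psiSup (M : LayerMesh β σ N ε φ φ') {t : ℝ}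
    (ht : t ∈ Set.Icc (0 : ℝ) (1 / 4)) :
    |(-(φ' t)) * Real.exp (-(φ t))| ≤ psiSup φ φ' := by
  have hφ : ContinuousOn φ (Set.Icc (0 : ℝ) (1 / 4)) :=
    fun s hs => (M.hderiv s hs).continuousWithinAt
  refine le_csSup (isCompact_Icc.image_of_continuousOn ?_).bddAbove ⟨t, ht, rfl⟩
  exact (M.hcont.neg.mul hφ.neg.rexp).abs

theorem exp_neg_sub_le (M : LayerMesh β σ N ε φ φ') {s t : ℝ}
    (hs : s ∈ Set.Icc (0 : ℝ) (1 / 4)) (ht : t ∈ Set.Icc (0 : ℝ) (1 / 4)) (hst : s ≤ t) :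
    Real.exp (-φ s) - Real.exp (-φ t) ≤ psiSup φ φ' * (t - s) := by
  have h := (convex_Icc (0 : ℝ) (1 / 4)).norm_image_sub_le_of_norm_hasDerivWithin_le
    (f := fun u => Real.exp (-φ u)) (f' := fun u => (-(φ' u)) * Real.exp (-(φ u)))
    (fun u hu => by simpa [mul_comm] using (M.hderiv u hu).neg.exp)
    (fun u hu => M.abs_deriv_le_psiSup hu) ht hs
  rw [Real.norm_eq_abs, Real.norm_eq_abs, abs_sub_comm s t,
    abs_of_nonneg (sub_nonneg.2 hst)] at h
  exact (le_abs_self _).trans h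

theorem div_mem_Icc {j : ℕ} (hN : 0 < N) (hj : j ≤ N / 4) :
    (j : ℝ) / N ∈ Set.Icc (0 : ℝ) (1 / 4) := by
  have hN' : (0 : ℝ) < N := by exact_mod_cast hN
  have hj' : (j : ℝ) * 4 ≤ N := by exact_mod_cast (show j * 4 ≤ N by omega)
  refine ⟨by positivity, ?_⟩
  rw [div_le_iff₀ hN']
  linarith

end LayerMesh

theorem stmt15 (β σ : ℝ) (k : ℕ) (hβ : 0 < β) (hσ : 0 < σ)
    (hσk : (k : ℝ) + 3/2 ≤ σ) :
    ∃ C : ℝ, 0 < C ∧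
      ∀ (N : ℕ) (ε : ℝ) (φ φ' : ℝ → ℝ) (M : LayerMesh β σ N ε φ φ'),
        ∑ i ∈ Finset.Icc 1 (N / 4),
            (min (M.h i / Real.sqrt ε) 1) ^ (2 * k + 3)
              * Real.exp (-(2 * β * M.x (i - 1)) / Real.sqrt ε)
          ≤ C * ((N : ℝ)⁻¹ * psiSup φ φ') ^ (2 * (k + 1)) := by
  have hc : 0 < σ / β := by positivity
  refine ⟨(1 + σ / β) ^ (2 * k + 3), by positivity, fun N ε φ φ' M => ?_⟩
  have hN : 0 < N := by have := M.hN; omega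
  have hN' : (0 : ℝ) < N := by exact_mod_cast hN
  have hε : 0 < Real.sqrt ε := Real.sqrt_pos.2 M.hε
  set S := (N : ℝ)⁻¹ * psiSup φ φ'
  set ψ : ℕ → ℝ := fun j => Real.exp (-φ ((j : ℝ) / N))
  rw [← Finset.Ico_add_one_right_eq_Icc, Finset.sum_Ico_eq_sum_range, Nat.add_sub_cancel]
  have hterm : ∀ j ∈ Finset.range (N / 4),
      (min (M.h (1 + j) / Real.sqrt ε) 1) ^ (2 * k + 3)
        * Real.exp (-(2 * β * M.x (1 + j - 1)) / Real.sqrt ε)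
      ≤ (1 + σ / β) ^ (2 * k + 3) * S ^ (2 * (k + 1)) * (ψ j - ψ (j + 1)) := by
    intro j hj
    have hj : j + 1 ≤ N / 4 := Finset.mem_range.1 hj
    have hm₀ := LayerMesh.div_mem_Icc hN (show j ≤ N / 4 by omega)
    have hm₁ := LayerMesh.div_mem_Icc hN hj
    have hle : (j : ℝ) / N ≤ ((j + 1 : ℕ) : ℝ) / N := by
      gcongr
      simp
    have hx₀ := M.hx_left j (by omega)
    have hx₁ := M.hx_left (j + 1) hj
    have hφ := M.monotoneOn hm₀ hm₁ hle
    have hφ₀ : 0 ≤ φ ((j : ℝ) / N) := by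
      rw [← M.hφ0]
      exact M.monotoneOn ⟨le_rfl, by norm_num⟩ hm₀ hm₀.1
    have hdiff : ψ j - ψ (j + 1) ≤ S := by
      refine (M.exp_neg_sub_le hm₀ hm₁ hle).trans_eq ?_
      simp only [S]
      push_cast
      field_simp
      ring
    have hdiff₀ : 0 ≤ ψ j - ψ (j + 1) :=
      sub_nonneg.2 (Real.exp_le_exp.2 (neg_le_neg hφ))
    have hh : M.h (1 + j) / Real.sqrt ε
        = σ / β * (φ (((j + 1 : ℕ) : ℝ) / N) - φ ((j : ℝ) / N)) := by
      rw [LayerMesh.h, Nat.add_sub_cancel_left, add_comm 1 j, hx₀, hx₁]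
      field_simp
    have hexponent : -(2 * β * M.x (1 + j - 1)) / Real.sqrt ε = -(2 * σ * φ ((j : ℝ) / N)) := by
      rw [Nat.add_sub_cancel_left, hx₀]
      field_simp
    have hmin₀ : 0 ≤ min (M.h (1 + j) / Real.sqrt ε) 1 := by
      rw [hh]
      exact le_min (mul_nonneg hc.le (sub_nonneg.2 hφ)) zero_le_one
    have hexp : Real.exp (-(2 * β * M.x (1 + j - 1)) / Real.sqrt ε) ≤ ψ j ^ (2 * k + 3) := by
      rw [hexponent, ← Real.exp_nat_mul]
      apply Real.exp_le_exp.2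
      push_cast
      nlinarith [mul_le_mul_of_nonneg_right hσk hφ₀]
    have hΘ : min (M.h (1 + j) / Real.sqrt ε) 1 * ψ j ≤ (1 + σ / β) * (ψ j - ψ (j + 1)) := by
      rw [hh]
      refine (mul_le_mul_of_nonneg_right (min_mul_one_le_mul_one_sub_exp_neg hc.le
        (sub_nonneg.2 hφ)) (Real.exp_pos _).le).trans_eq ?_
      rw [mul_assoc, sub_mul, one_mul, ← Real.exp_add]
      simp only [ψ]
      ring_nf
    calc _ ≤ (min (M.h (1 + j) / Real.sqrt ε) 1) ^ (2 * k + 3) * ψ j ^ (2 * k + 3) := by gcongr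
      _ = (min (M.h (1 + j) / Real.sqrt ε) 1 * ψ j) ^ (2 * k + 3) := (mul_pow _ _ _).symm
      _ ≤ ((1 + σ / β) * (ψ j - ψ (j + 1))) ^ (2 * k + 3) :=
        pow_le_pow_left₀ (mul_nonneg hmin₀ (Real.exp_pos _).le) hΘ _
      _ = (1 + σ / β) ^ (2 * k + 3) * (ψ j - ψ (j + 1)) ^ (2 * (k + 1))
          * (ψ j - ψ (j + 1)) := by rw [mul_pow, mul_assoc, ← pow_succ]; rfl
      _ ≤ _ := by gcongr
  refine (Finset.sum_le_sum hterm).trans ?_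
  rw [← Finset.mul_sum, Finset.sum_range_sub']
  have hS : 0 ≤ S ^ (2 * (k + 1)) := (even_two_mul _).pow_nonneg _
  have hψ : ψ 0 - ψ (N / 4) ≤ 1 := by
    have h₀ : ψ 0 = 1 := by simp [ψ, M.hφ0]
    have h₁ : 0 < ψ (N / 4) := Real.exp_pos _
    linarith
  exact mul_le_of_le_one_right (by positivity) hψ
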